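/- Let G₁, G₂ be hyperbolic groups with quasiconvex subgroups H₁, H₂ of infinite index, limit sets Λ₁, Λ₂, and collections 𝒥ᵢ of joins of translates of Λᵢ by representatives of distinct cosets of Hᵢ. If φ : 𝒥₁ → 𝒥₂ is a uniformly proper bijection, then φ induces a simplicial isomorphism of the C-complex C(G₁,H₁) with the C-complex C(G₂,H₂). -/

import Mathlib

/-!
Common coarse-geometric definitions used to formalize statements from
"Relative Rigidity, Quasiconvexity and C-Complexes" (Mahan Mj).

We model the Cayley graph of a finitely generated group by the group itself
equipped with a word metric (the vertex set of the Cayley graph, with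
bi-infinite geodesics modelled by `ℤ`-parametrized discrete geodesics), and we
set up all basic notions (Gromov products, hyperbolicity, the Gromov boundary
via Gromov sequences, limit sets, joins, quasiconvexity, electric metrics and
relative hyperbolicity à la Farb, uniformly proper maps, quasi-isometries)
relative to an abstract distance function `d : α → α → ℝ`.
-/

open Filter Set Metric
open scoped ENNReal

noncomputable section

namespace RelRig

universe u v

variable {α β : Type*}

/-- Gromov product of `x`, `y` based at `w`. -/
def gpD (d : α → α → ℝ) (w x y : α) : ℝ := (d w x + d w y - d x y) / 2

/-- `d` satisfies the Gromov four-point condition with constant `δ`. -/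
def DeltaHypD (d : α → α → ℝ) (δ : ℝ) : Prop :=
  ∀ w x y z : α, min (gpD d w x y) (gpD d w y z) - δ ≤ gpD d w x z

/-- `d` is Gromov-hyperbolic. -/
def HypD (d : α → α → ℝ) : Prop := ∃ δ ≥ (0 : ℝ), DeltaHypD d δ

/-- distance from a point to a set. -/
def pdistD (d : α → α → ℝ) (x : α) (A : Set α) : ℝ := sInf {r | ∃ a ∈ A, r = d x a}

/-- (infimal) distance between two sets. -/
def setDistD (d : α → α → ℝ) (A B : Set α) : ℝ := sInf {r | ∃ a ∈ A, ∃ b ∈ B, r = d a b}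

/-- closed `r`-neighbourhood of a set. -/
def nbdD (d : α → α → ℝ) (r : ℝ) (A : Set α) : Set α := {x | ∃ a ∈ A, d x a ≤ r}

/-- a sequence going to infinity (a "Gromov sequence"). -/
def GromovSeqD (d : α → α → ℝ) (w : α) (s : ℕ → α) : Prop :=
  Tendsto (fun p : ℕ × ℕ => gpD d w (s p.1) (s p.2)) atTop atTop

/-- asymptoticity of Gromov sequences. -/
def bdryRelD (d : α → α → ℝ) (w : α) (s t : {u : ℕ → α // GromovSeqD d w u}) : Prop :=
  Tendsto (fun p : ℕ × ℕ => gpD d w (s.1 p.1) (t.1 p.2)) atTop atTop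

/-- The Gromov boundary of `(α, d)`: asymptoticity classes of Gromov sequences. -/
def BdryD (d : α → α → ℝ) (w : α) := Quot (bdryRelD d w)

/-- `s` converges to the boundary point `ξ`. -/
def ConvTo (d : α → α → ℝ) (w : α) (s : ℕ → α) (ξ : BdryD d w) : Prop :=
  ∃ hs : GromovSeqD d w s, Quot.mk (bdryRelD d w) ⟨s, hs⟩ = ξ

/-- the limit set of a subset `A ⊆ α` in the Gromov boundary. -/
def limitSetD (d : α → α → ℝ) (w : α) (A : Set α) : Set (BdryD d w) :=
  {ξ | ∃ s : ℕ → α, (∀ n, s n ∈ A) ∧ ConvTo d w s ξ}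

/-- Gromov product of two boundary points. -/
def bgpD (d : α → α → ℝ) (w : α) (ξ η : BdryD d w) : ℝ≥0∞ :=
  ⨆ s : {s : ℕ → α // ConvTo d w s ξ}, ⨆ t : {t : ℕ → α // ConvTo d w t η},
    Filter.liminf (fun p : ℕ × ℕ => ENNReal.ofReal (gpD d w (s.1 p.1) (t.1 p.2))) atTop

open Classical in
/-- the visual (quasi-)metric on the boundary. -/
def vdistD (d : α → α → ℝ) (w : α) (ξ η : BdryD d w) : ℝ :=
  if ξ = η then 0 else Real.exp (-(bgpD d w ξ η).toReal)

/-- visual diameter of a subset of the boundary. -/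
def vdiamD (d : α → α → ℝ) (w : α) (Λ : Set (BdryD d w)) : ℝ :=
  sSup {r | ∃ ξ ∈ Λ, ∃ η ∈ Λ, r = vdistD d w ξ η}

/-- Hausdorff distance between two subsets of the boundary (visual metric). -/
def vHdistD (d : α → α → ℝ) (w : α) (A B : Set (BdryD d w)) : ℝ :=
  max (sSup {r | ∃ a ∈ A, r = sInf {t | ∃ b ∈ B, t = vdistD d w a b}})
      (sSup {r | ∃ b ∈ B, r = sInf {t | ∃ a ∈ A, t = vdistD d w a b}})

/-- closed subsets of the boundary w.r.t. the visual metric. -/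
def VClosed (d : α → α → ℝ) (w : α) (K : Set (BdryD d w)) : Prop :=
  ∀ ξ : BdryD d w, (∀ ε > (0 : ℝ), ∃ η ∈ K, vdistD d w ξ η < ε) → ξ ∈ K

/-- A family (multiset) of boundary subsets is a discrete subset of `C_c⁰(∂X)`,
the space of closed subsets of the boundary having more than one point, with the
Hausdorff topology: the family does not accumulate (with multiplicity) at any
closed subset of the boundary having more than one point. -/
def DiscreteFamilyD {ι : Type*} (d : α → α → ℝ) (w : α) (L : ι → Set (BdryD d w)) : Prop :=
  ∀ K : Set (BdryD d w), VClosed d w K → K.Nontrivial →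
    ¬ (∀ ε > (0 : ℝ), {i : ι | vHdistD d w (L i) K < ε}.Infinite)

/-- discrete geodesic of length `m` (suitable for graphs/word metrics). -/
def DiscGeodD (d : α → α → ℝ) (c : ℕ → α) (m : ℕ) : Prop :=
  ∀ i, i ≤ m → ∀ j, j ≤ m → d (c i) (c j) = |(i : ℝ) - (j : ℝ)|

/-- discrete bi-infinite geodesic. -/
def DiscLineD (d : α → α → ℝ) (γ : ℤ → α) : Prop :=
  ∀ i j : ℤ, d (γ i) (γ j) = |(i : ℝ) - (j : ℝ)|

/-- `A` is a `K`-quasiconvex subset: every (discrete) geodesic with endpoints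
in `A` stays in the `K`-neighbourhood of `A`. -/
def QCSetD (d : α → α → ℝ) (K : ℝ) (A : Set α) : Prop :=
  ∀ (c : ℕ → α) (m : ℕ), DiscGeodD d c m → c 0 ∈ A → c m ∈ A →
    ∀ i, i ≤ m → pdistD d (c i) A ≤ K

/-- both endpoints of the bi-infinite geodesic `γ` lie in `Λ`. -/
def LineEndsInD (d : α → α → ℝ) (w : α) (γ : ℤ → α) (Λ : Set (BdryD d w)) : Prop :=
  (∃ ξ ∈ Λ, ConvTo d w (fun n : ℕ => γ (n : ℤ)) ξ) ∧
  (∃ η ∈ Λ, ConvTo d w (fun n : ℕ => γ (-(n : ℤ))) η)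

/-- the join `J(Λ)`: the union of all bi-infinite geodesics with both endpoints in `Λ`. -/
def joinD (d : α → α → ℝ) (w : α) (Λ : Set (BdryD d w)) : Set α :=
  {p | ∃ γ : ℤ → α, DiscLineD d γ ∧ LineEndsInD d w γ Λ ∧ p ∈ Set.range γ}

/-- a nearest-point projection onto `A`. -/
def IsNearestProjD (d : α → α → ℝ) (A : Set α) (P : α → α) : Prop :=
  ∀ x : α, P x ∈ A ∧ ∀ a ∈ A, d x (P x) ≤ d x a

/-- uniformly proper pairing of two collections of subsets (Schwarz, Mj). -/
def UProperD {ι κ : Type*} (d₁ : α → α → ℝ) (d₂ : β → β → ℝ)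
    (J₁ : ι → Set α) (J₂ : κ → Set β) (φ : ι → κ) : Prop :=
  ∃ f : ℕ → ℕ, ∀ (n : ℕ) (i i' : ι),
    (setDistD d₁ (J₁ i) (J₁ i') ≤ (n : ℝ) →
      setDistD d₂ (J₂ (φ i)) (J₂ (φ i')) ≤ (f n : ℝ)) ∧
    (setDistD d₂ (J₂ (φ i)) (J₂ (φ i')) ≤ (n : ℝ) →
      setDistD d₁ (J₁ i) (J₁ i') ≤ (f n : ℝ))

/-- `q` pairs the collections `J₁`, `J₂` as `φ` does. -/
def PairsAsD {ι κ : Type*} (d₁ : α → α → ℝ) (d₂ : β → β → ℝ)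
    (q : α → β) (J₁ : ι → Set α) (J₂ : κ → Set β) (φ : ι → κ) : Prop :=
  ∃ h : ℕ → ℕ, ∀ (n : ℕ) (p : α) (i : ι),
    pdistD d₁ p (J₁ i) ≤ (n : ℝ) → pdistD d₂ (q p) (J₂ (φ i)) ≤ (h n : ℝ)

/-- quasi-isometry between `(α, d₁)` and `(β, d₂)`. -/
def QIMapD (d₁ : α → α → ℝ) (d₂ : β → β → ℝ) (q : α → β) : Prop :=
  ∃ lam C : ℝ, 1 ≤ lam ∧ 0 ≤ C ∧
    (∀ x y : α, d₂ (q x) (q y) ≤ lam * d₁ x y + C ∧ d₁ x y ≤ lam * d₂ (q x) (q y) + C) ∧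
    (∀ z : β, ∃ x : α, d₂ z (q x) ≤ C)

/-! ### Word metrics, quasiconvex subgroups, limit sets of cosets -/

section Groups
variable {G : Type*} [Group G]

/-- the word metric associated to a (symmetrized) generating set `S`. -/
def wdist (S : Set G) (g h : G) : ℝ :=
  sInf {r | ∃ l : List G, (∀ x ∈ l, x ∈ S ∨ x⁻¹ ∈ S) ∧ l.prod = g⁻¹ * h ∧ r = (l.length : ℝ)}

/-- the left coset `gH` as a subset of `G`. -/
def cosetSet (H : Subgroup G) (g : G) : Set G := {x | g⁻¹ * x ∈ H}

/-- `R` contains exactly one representative of each left coset of `H`. -/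
def IsCosetReps (H : Subgroup G) (R : Set G) : Prop :=
  ∀ g : G, ∃! r : G, r ∈ R ∧ g⁻¹ * r ∈ H

/-- the translate `gΛ(H)` of the limit set of `H` in the Gromov boundary:
the limit set of the coset `gH`. -/
def cosetLimitSet (S : Set G) (H : Subgroup G) (g : G) : Set (BdryD (wdist S) (1 : G)) :=
  limitSetD (wdist S) 1 (cosetSet H g)

/-- the join `J(gΛ(H))` of the translate `gΛ(H)` of the limit set of `H`. -/
def cosetJoin (S : Set G) (H : Subgroup G) (g : G) : Set G :=
  joinD (wdist S) 1 (cosetLimitSet S H g)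

/-- quasiconvex subgroup w.r.t. the word metric of `S`. -/
def QCSubgroup (S : Set G) (H : Subgroup G) : Prop :=
  ∃ C ≥ (0 : ℝ), QCSetD (wdist S) C (H : Set G)

/-- malnormal subgroup: `gHg⁻¹ ∩ H` is trivial for `g ∉ H`. -/
def Malnormal (H : Subgroup G) : Prop :=
  ∀ g : G, g ∉ H → ∀ x : G, x ∈ H → g * x * g⁻¹ ∈ H → x = 1

end Groups

/-! ### Relative hyperbolicity (Farb: electric space + bounded penetration) -/

section RelHyp
variable {α : Type*}

open Classical in
/-- cost of one step of an electric chain: travelling within a horosphere-like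
set costs at most `1` (passing through the cone point). -/
def stepCost (d : α → α → ℝ) (ℋ : Set (Set α)) (a b : α) : ℝ :=
  if ∃ H ∈ ℋ, a ∈ H ∧ b ∈ H then min 1 (d a b) else d a b

/-- electric length of the portion `[i, j]` of a chain. -/
def chainLen (d : α → α → ℝ) (ℋ : Set (Set α)) (p : ℕ → α) (i j : ℕ) : ℝ :=
  ∑ k ∈ Finset.Ico i j, stepCost d ℋ (p k) (p (k + 1))

/-- the electric (coned-off) pseudo-metric of Farb's electric space. -/
def elDist (d : α → α → ℝ) (ℋ : Set (Set α)) (x y : α) : ℝ :=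
  sInf {r | ∃ (n : ℕ) (p : ℕ → α), p 0 = x ∧ p n = y ∧ r = chainLen d ℋ p 0 n}

/-- weak relative hyperbolicity: the electric space is hyperbolic. -/
def WeakRelHyp (d : α → α → ℝ) (ℋ : Set (Set α)) : Prop := HypD (elDist d ℋ)

/-- an electric `P`-quasigeodesic chain. -/
def ElQG (d : α → α → ℝ) (ℋ : Set (Set α)) (P : ℝ) (p : ℕ → α) (n : ℕ) : Prop :=
  ∀ i j : ℕ, i ≤ j → j ≤ n → chainLen d ℋ p i j ≤ P * elDist d ℋ (p i) (p j) + P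

/-- the chain does not return to the `ε`-neighbourhood of any horosphere-like
set after leaving it. -/
def NoBacktrack (d : α → α → ℝ) (ℋ : Set (Set α)) (ε : ℝ) (p : ℕ → α) (n : ℕ) : Prop :=
  ∀ H ∈ ℋ, ∀ i j k : ℕ, i < j → j < k → k ≤ n →
    p i ∈ nbdD d ε H → p k ∈ nbdD d ε H → p j ∈ nbdD d ε H

/-- the chain meets `S`. -/
def MeetsChain (p : ℕ → α) (n : ℕ) (S : Set α) : Prop := ∃ i ≤ n, p i ∈ S

/-- `i` is the entry point of the chain into the `ε`-neighbourhood of `H`. -/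
def IsEntry (d : α → α → ℝ) (ε : ℝ) (H : Set α) (p : ℕ → α) (n i : ℕ) : Prop :=
  i ≤ n ∧ p i ∈ nbdD d ε H ∧ ∀ j, j < i → p j ∉ nbdD d ε H

/-- `i` is the exit point of the chain from the `ε`-neighbourhood of `H`. -/
def IsExit (d : α → α → ℝ) (ε : ℝ) (H : Set α) (p : ℕ → α) (n i : ℕ) : Prop :=
  i ≤ n ∧ p i ∈ nbdD d ε H ∧ ∀ j, i < j → j ≤ n → p j ∉ nbdD d ε H

/-- coarse intrinsic path-metric of a subset `S`. -/
def inDist (d : α → α → ℝ) (S : Set α) (x y : α) : ℝ :=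
  sInf {r | ∃ (n : ℕ) (p : ℕ → α), p 0 = x ∧ p n = y ∧ (∀ i, i ≤ n → p i ∈ S) ∧
    (∀ i, i < n → d (p i) (p (i + 1)) ≤ 1) ∧
    r = ∑ k ∈ Finset.range n, d (p k) (p (k + 1))}

/-- Bounded penetration: electric quasigeodesics without backtracking with the
same endpoints have similar intersection patterns with horosphere-like sets. -/
def BddPenetration (d : α → α → ℝ) (ℋ : Set (Set α)) : Prop :=
  ∀ P ≥ (1 : ℝ), ∃ ε ≥ (0 : ℝ), ∃ D ≥ (0 : ℝ),
    ∀ (p q : ℕ → α) (n m : ℕ), p 0 = q 0 → p n = q m →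
      ElQG d ℋ P p n → ElQG d ℋ P q m →
      NoBacktrack d ℋ ε p n → NoBacktrack d ℋ ε q m →
      ∀ H ∈ ℋ,
        (¬ MeetsChain q m (nbdD d ε H) →
          ∀ i j, IsEntry d ε H p n i → IsExit d ε H p n j →
            inDist d (nbdD d ε H) (p i) (p j) ≤ D) ∧
        (MeetsChain q m (nbdD d ε H) →
          (∀ i j, IsEntry d ε H p n i → IsEntry d ε H q m j →
            inDist d (nbdD d ε H) (p i) (q j) ≤ D) ∧
          (∀ i j, IsExit d ε H p n i → IsExit d ε H q m j →
            inDist d (nbdD d ε H) (p i) (q j) ≤ D))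

/-- the collection `ℋ` is uniformly separated. -/
def UnifSeparated (d : α → α → ℝ) (ℋ : Set (Set α)) : Prop :=
  ∃ ε > (0 : ℝ), ∀ H₁ ∈ ℋ, ∀ H₂ ∈ ℋ, H₁ ≠ H₂ → ε ≤ setDistD d H₁ H₂

/-- strong relative hyperbolicity (Farb's definition; equivalent to Gromov's
definition via hyperbolic cones, by Bowditch). -/
def StrongRelHyp (d : α → α → ℝ) (ℋ : Set (Set α)) : Prop :=
  UnifSeparated d ℋ ∧ WeakRelHyp d ℋ ∧ BddPenetration d ℋ

end RelHyp

/-! ### Geodesic metric spaces, CAT(0) spaces, flats, symmetric spaces -/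

section MetricGeo
variable {X : Type*} [MetricSpace X]

/-- `γ` is a unit-speed parametrization of a geodesic from `x` to `y`. -/
def GeodParam (γ : ℝ → X) (x y : X) : Prop :=
  γ 0 = x ∧ γ (dist x y) = y ∧
    ∀ s ∈ Icc (0 : ℝ) (dist x y), ∀ t ∈ Icc (0 : ℝ) (dist x y), dist (γ s) (γ t) = |s - t|

/-- `s` is (the image of) a geodesic segment from `x` to `y`. -/
def IsGeodSeg (x y : X) (s : Set X) : Prop :=
  ∃ γ : ℝ → X, GeodParam γ x y ∧ s = γ '' Icc (0 : ℝ) (dist x y)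

/-- geodesic metric space. -/
def GeodesicSpace (X : Type*) [MetricSpace X] : Prop := ∀ x y : X, ∃ s : Set X, IsGeodSeg x y s

/-- `A` is a `K`-quasiconvex subset of the metric space `X`. -/
def QCSet (K : ℝ) (A : Set X) : Prop :=
  ∀ x ∈ A, ∀ y ∈ A, ∀ s : Set X, IsGeodSeg x y s → ∀ p ∈ s, Metric.infDist p A ≤ K

/-- `γ` is a bi-infinite (unit-speed) geodesic. -/
def IsGeodLine (γ : ℝ → X) : Prop := ∀ a b : ℝ, dist (γ a) (γ b) = |a - b|

/-- both endpoints of the geodesic line `γ` lie in `Λ`. -/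
def lineEndsIn (w : X) (γ : ℝ → X) (Λ : Set (BdryD (fun x y : X => dist x y) w)) : Prop :=
  (∃ ξ ∈ Λ, ConvTo (fun x y : X => dist x y) w (fun n : ℕ => γ (n : ℝ)) ξ) ∧
  (∃ η ∈ Λ, ConvTo (fun x y : X => dist x y) w (fun n : ℕ => γ (-(n : ℝ))) η)

/-- the join of `Λ ⊆ ∂X`: the union of bi-infinite geodesics with endpoints in `Λ`. -/
def joinR (w : X) (Λ : Set (BdryD (fun x y : X => dist x y) w)) : Set X :=
  {p | ∃ γ : ℝ → X, IsGeodLine γ ∧ lineEndsIn w γ Λ ∧ p ∈ Set.range γ}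

/-- CAT(0) space, via the CN (Bruhat–Tits) midpoint inequality. -/
def CAT0 (X : Type*) [MetricSpace X] : Prop :=
  GeodesicSpace X ∧ ∀ x y z m : X, dist y m = dist y z / 2 → dist z m = dist y z / 2 →
    dist x m ^ 2 ≤ (dist x y ^ 2 + dist x z ^ 2) / 2 - dist y z ^ 2 / 4

/-- a `k`-flat: an isometrically embedded copy of Euclidean `k`-space. -/
def FlatOfDim (k : ℕ) (F : Set X) : Prop :=
  ∃ f : EuclideanSpace ℝ (Fin k) → X, Isometry f ∧ Set.range f = F

/-- a flat (of dimension at least 2). -/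
def IsFlat2 (F : Set X) : Prop := ∃ k : ℕ, 2 ≤ k ∧ FlatOfDim k F

/-- a maximal flat. -/
def IsMaxFlat (F : Set X) : Prop := IsFlat2 F ∧ ∀ F' : Set X, IsFlat2 F' → F ⊆ F' → F' = F

/-- isolated flats: every flat is uniformly close to a maximal one, and
neighbourhoods of distinct maximal flats have uniformly bounded overlap. -/
def IsolatedFlats (X : Type*) [MetricSpace X] : Prop :=
  (∃ D ≥ (0 : ℝ), ∀ F : Set X, IsFlat2 F →
    ∃ F' : Set X, IsMaxFlat F' ∧ ∀ x ∈ F, Metric.infDist x F' ≤ D) ∧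
  (∀ ρ ≥ (0 : ℝ), ∃ κ ≥ (0 : ℝ), ∀ F F' : Set X, IsMaxFlat F → IsMaxFlat F' → F ≠ F' →
    ∀ x y : X, Metric.infDist x F ≤ ρ → Metric.infDist x F' ≤ ρ →
      Metric.infDist y F ≤ ρ → Metric.infDist y F' ≤ ρ → dist x y ≤ κ)

/-- a (globally) symmetric space of non-positive curvature: a CAT(0) space with
a geodesic point-symmetry at every point. -/
def SymmSpaceNonpos (X : Type*) [MetricSpace X] : Prop :=
  CAT0 X ∧ ∀ x : X, ∃ σ : X ≃ᵢ X, σ x = x ∧ ∀ y : X, dist y (σ y) = 2 * dist x y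

/-- `X` has rank `r`: it contains an `r`-flat but no `(r+1)`-flat. -/
def HasRank (X : Type*) [MetricSpace X] (r : ℕ) : Prop :=
  (∃ F : Set X, FlatOfDim r F) ∧ ∀ F : Set X, ¬ FlatOfDim (r + 1) F

end MetricGeo

/-! ### Group actions -/

/-- a geometric action: by isometries, metrically proper and cobounded. -/
def GeometricAction (G : Type*) [Group G] (X : Type*) [MetricSpace X] [MulAction G X] : Prop :=
  (∀ g : G, Isometry (fun x : X => g • x)) ∧
  (∀ x₀ : X, ∀ r : ℝ, {g : G | dist x₀ (g • x₀) ≤ r}.Finite) ∧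
  (∀ x₀ : X, ∃ C : ℝ, ∀ x : X, ∃ g : G, dist x (g • x₀) ≤ C)

/-- `𝒥` is the `G`-equivariant family of lifts of a maximal totally geodesic
torus (of dimension `r = rank`) in the compact locally symmetric space `X/G`:
an orbit of a periodic `r`-flat. -/
def TorusLiftFamily (G : Type*) [Group G] {X : Type*} [MetricSpace X] [MulAction G X]
    (r : ℕ) (𝒥 : Set (Set X)) : Prop :=
  (∀ J ∈ 𝒥, FlatOfDim r J) ∧
  (∃ F₀ ∈ 𝒥, 𝒥 = {J : Set X | ∃ g : G, J = (fun x : X => g • x) '' F₀}) ∧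
  (∃ C ≥ (0 : ℝ), ∀ J ∈ 𝒥, ∀ x ∈ J, ∀ y ∈ J,
    ∃ g : G, (fun z : X => g • z) '' J = J ∧ dist x (g • y) ≤ C)

/-! ### Convergence groups, annulus systems and cross-ratios (Bowditch) -/

/-- the space of distinct triples of `M`. -/
def distinctTriples (M : Type*) : Set (M × M × M) :=
  {p | p.1 ≠ p.2.1 ∧ p.1 ≠ p.2.2 ∧ p.2.1 ≠ p.2.2}

/-- the diagonal action on triples. -/
def tripleAct {G M : Type*} [Group G] [MulAction G M] (g : G) (p : M × M × M) : M × M × M :=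
  (g • p.1, g • p.2.1, g • p.2.2)

/-- a uniform convergence group action: the action on the space of distinct
triples is properly discontinuous and cocompact. -/
def UniformConvergenceAction (G : Type*) [Group G] (M : Type*) [TopologicalSpace M]
    [MulAction G M] : Prop :=
  (∀ g : G, Continuous (fun x : M => g • x)) ∧
  (∀ K : Set (M × M × M), K ⊆ distinctTriples M → IsCompact K →
    {g : G | (tripleAct g '' K ∩ K).Nonempty}.Finite) ∧
  (∃ K : Set (M × M × M), K ⊆ distinctTriples M ∧ IsCompact K ∧
    ∀ p ∈ distinctTriples M, ∃ g : G, tripleAct g p ∈ K)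

/-- an (unconstrained) ordered pair of subsets of `M`. -/
structure Ann (M : Type*) where
  minus : Set M
  plus : Set M

/-- `A` is an annulus: an ordered pair of disjoint closed subsets not covering `M`. -/
def IsAnnulusOn (M : Type*) [TopologicalSpace M] (A : Ann M) : Prop :=
  IsClosed A.minus ∧ IsClosed A.plus ∧ Disjoint A.minus A.plus ∧ A.minus ∪ A.plus ≠ Set.univ

/-- translate of an annulus. -/
def annAct {G M : Type*} [Group G] [MulAction G M] (g : G) (A : Ann M) : Ann M :=
  ⟨(fun x : M => g • x) '' A.minus, (fun x : M => g • x) '' A.plus⟩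

/-- a nested chain of `m` annuli of `𝒜` separating `K` from `L`:
`K < A₁ < ⋯ < A_m < L`. -/
def SepChain {M : Type*} [TopologicalSpace M] (𝒜 : Set (Ann M)) (K L : Set M) (m : ℕ) : Prop :=
  m = 0 ∨ ∃ A : ℕ → Ann M, (∀ i, i < m → A i ∈ 𝒜) ∧
    K ⊆ interior (A 0).minus ∧ L ⊆ interior (A (m - 1)).plus ∧
    ∀ i, i + 1 < m → interior (A i).minus ∪ interior (A (i + 1)).plus = Set.univ

/-- the annular cross-ratio `(K|L)_𝒜 ∈ ℕ ∪ {∞}`. -/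
def crossRatioAnn {M : Type*} [TopologicalSpace M] (𝒜 : Set (Ann M)) (K L : Set M) : ℕ∞ :=
  sSup {n : ℕ∞ | ∃ m : ℕ, n = (m : ℕ∞) ∧ SepChain 𝒜 K L m}

/-- the limit set of a subgroup of a convergence group. -/
def convLimitSet {G : Type*} [Group G] {M : Type*} [TopologicalSpace M] [MulAction G M]
    (H : Subgroup G) : Set M :=
  {ξ : M | ∃ h : ℕ → H, Function.Injective h ∧
    ∃ x : M, Tendsto (fun n => (h n : G) • x) atTop (nhds ξ)}

/-- discreteness of a family (multiset) of subsets of a metrizable compactum `M`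
in the Hausdorff topology on the space of closed subsets of `M` with more than
one point. -/
def DiscreteFamilyM {ι M : Type*} [MetricSpace M] (L : ι → Set M) : Prop :=
  ∀ K : Set M, IsClosed K → K.Nontrivial →
    ¬ (∀ ε > (0 : ℝ), {i : ι | Metric.hausdorffDist (L i) K < ε}.Infinite)

/-- uniform properness of a pairing with respect to annular cross-ratios. -/
def UProperCRFam {ι κ M₁ M₂ : Type*} [TopologicalSpace M₁] [TopologicalSpace M₂]
    (𝒜₁ : Set (Ann M₁)) (𝒜₂ : Set (Ann M₂))
    (L₁ : ι → Set M₁) (L₂ : κ → Set M₂) (φ : ι → κ) : Prop :=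
  ∃ f : ℕ → ℕ, ∀ (n : ℕ) (i i' : ι),
    (crossRatioAnn 𝒜₁ (L₁ i) (L₁ i') ≤ (n : ℕ∞) →
      crossRatioAnn 𝒜₂ (L₂ (φ i)) (L₂ (φ i')) ≤ (f n : ℕ∞)) ∧
    (crossRatioAnn 𝒜₂ (L₂ (φ i)) (L₂ (φ i')) ≤ (n : ℕ∞) →
      crossRatioAnn 𝒜₁ (L₁ i) (L₁ i') ≤ (f n : ℕ∞))


/-! ### Word metrics: basic facts -/

/-- The properties of word metrics used below. -/
structure WM {G : Type*} [Group G] (d : G → G → ℝ) : Prop where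
  self : ∀ x, d x x = 0
  symm : ∀ x y, d x y = d y x
  tri : ∀ x y z, d x z ≤ d x y + d y z
  linv : ∀ g x y, d (g * x) (g * y) = d x y
  geod : ∀ x y, ∃ (c : ℕ → G) (m : ℕ), (m : ℝ) = d x y ∧ DiscGeodD d c m ∧ c 0 = x ∧ c m = y
  fin : ∀ r : ℝ, {x | d 1 x ≤ r}.Finite

section WordMetric
variable {G : Type*} [Group G]

theorem wdist_le_length (S : Set G) {g h : G} (l : List G) (hl : ∀ x ∈ l, x ∈ S ∨ x⁻¹ ∈ S)
    (hp : l.prod = g⁻¹ * h) : wdist S g h ≤ l.length := by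
  apply csInf_le
  · refine ⟨0, ?_⟩
    rintro r ⟨l, -, -, rfl⟩
    positivity
  · exact ⟨l, hl, hp, rfl⟩

theorem wdist_attained (S : Set G) (hS : Subgroup.closure S = ⊤) (g h : G) :
    ∃ l : List G, (∀ x ∈ l, x ∈ S ∨ x⁻¹ ∈ S) ∧ l.prod = g⁻¹ * h ∧ wdist S g h = l.length := by
  classical
  have hex : ∃ n : ℕ, ∃ l : List G, (∀ x ∈ l, x ∈ S ∨ x⁻¹ ∈ S) ∧ l.prod = g⁻¹ * h ∧
      l.length = n := by
    have : g⁻¹ * h ∈ Subgroup.closure S := by rw [hS]; trivial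
    rw [← Subgroup.mem_toSubmonoid, Subgroup.closure_toSubmonoid] at this
    obtain ⟨l, hl, hp⟩ := Submonoid.exists_list_of_mem_closure this
    exact ⟨l.length, l, fun x hx => by simpa using hl x hx, hp, rfl⟩
  obtain ⟨l, hl, hp, hn⟩ := Nat.find_spec hex
  refine ⟨l, hl, hp, le_antisymm (wdist_le_length S l hl hp) ?_⟩
  apply le_csInf
  · exact ⟨_, l, hl, hp, rfl⟩
  · rintro r ⟨l', hl', hp', rfl⟩
    rw [hn]
    exact_mod_cast Nat.find_min' hex ⟨l', hl', hp', rfl⟩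

theorem wdist_tri (S : Set G) (hS : Subgroup.closure S = ⊤) (x y z : G) :
    wdist S x z ≤ wdist S x y + wdist S y z := by
  obtain ⟨l, hl, hp, hd⟩ := wdist_attained S hS x y
  obtain ⟨l', hl', hp', hd'⟩ := wdist_attained S hS y z
  have := wdist_le_length S (g := x) (h := z) (l ++ l')
    (by
      intro a ha
      rcases List.mem_append.1 ha with h | h
      · exact hl a h
      · exact hl' a h)
    (by rw [List.prod_append, hp, hp']; group)
  rw [hd, hd']
  simpa using this

theorem wdist_symm_le (S : Set G) (hS : Subgroup.closure S = ⊤) (x y : G) :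
    wdist S x y ≤ wdist S y x := by
  obtain ⟨l, hl, hp, hd⟩ := wdist_attained S hS y x
  have := wdist_le_length S (g := x) (h := y) (l.map (fun a => a⁻¹)).reverse
    (by
      intro a ha
      simp only [List.mem_reverse, List.mem_map] at ha
      obtain ⟨b, hb, rfl⟩ := ha
      rcases hl b hb with h | h
      · right; simpa using h
      · left; exact h)
    (by rw [← List.prod_inv_reverse, hp]; group)
  rw [hd]
  simpa using this

theorem wdist_WM (S : Set G) (hfin : S.Finite) (hS : Subgroup.closure S = ⊤) :
    WM (wdist S) where
  self x := by
    have h0 := wdist_le_length S (g := x) (h := x) [] (by simp) (by simp)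
    obtain ⟨l, -, -, hd⟩ := wdist_attained S hS x x
    have : (0 : ℝ) ≤ wdist S x x := by rw [hd]; positivity
    simp at h0
    linarith
  symm x y := le_antisymm (wdist_symm_le S hS x y) (wdist_symm_le S hS y x)
  tri := wdist_tri S hS
  linv g x y := by
    unfold wdist
    have : (g * x)⁻¹ * (g * y) = x⁻¹ * y := by group
    rw [this]
  geod x y := by
    obtain ⟨l, hl, hp, hd⟩ := wdist_attained S hS x y
    have hle : ∀ i j : ℕ, i ≤ j → wdist S (x * (l.take i).prod) (x * (l.take j).prod) ≤
        (j : ℝ) - i := by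
      intro i j hij
      have h1 := wdist_le_length S (g := x * (l.take i).prod) (h := x * (l.take j).prod)
        ((l.drop i).take (j - i))
        (by
          intro a ha
          exact hl a (List.mem_of_mem_drop (List.mem_of_mem_take ha)))
        (by
          have : (l.take j) = l.take i ++ (l.drop i).take (j - i) := by
            rw [← List.take_add]; congr 1; omega
          rw [this, List.prod_append]; group)
      refine h1.trans ?_
      rw [← Nat.cast_sub hij]
      exact_mod_cast List.length_take_le _ _
    have hend : x * (l.take l.length).prod = y := by
      rw [List.take_length, hp]; group
    have h0 : x * (l.take 0).prod = x := by simp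
    have heq : ∀ i j : ℕ, i ≤ j → j ≤ l.length →
        wdist S (x * (l.take i).prod) (x * (l.take j).prod) = (j : ℝ) - i := by
      intro i j hij hj
      refine le_antisymm (hle i j hij) ?_
      have a1 := hle 0 i (Nat.zero_le _)
      have a2 := hle j l.length hj
      rw [hend] at a2
      rw [h0] at a1
      have t1 := wdist_tri S hS x (x * (l.take i).prod) y
      have t2 := wdist_tri S hS (x * (l.take i).prod) (x * (l.take j).prod) y
      rw [hd] at t1
      push_cast at a1
      linarith
    refine ⟨fun i => x * (l.take i).prod, l.length, hd.symm, ?_, h0, hend⟩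
    intro i hi j hj
    rcases le_total i j with h | h
    · rw [heq i j h hj, abs_sub_comm, abs_of_nonneg]
      have : (i : ℝ) ≤ j := by exact_mod_cast h
      linarith
    · have hs := le_antisymm (wdist_symm_le S hS (x * (l.take i).prod) (x * (l.take j).prod))
        (wdist_symm_le S hS _ _)
      show wdist S (x * (l.take i).prod) (x * (l.take j).prod) = _
      rw [hs, heq j i h hi, abs_of_nonneg]
      have : (j : ℝ) ≤ i := by exact_mod_cast h
      linarith
  fin r := by
    have hT : (S ∪ (fun a => a⁻¹) '' S).Finite := hfin.union (hfin.image _)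
    have hL : ∀ n : ℕ, {l : List G | l.length ≤ n ∧ ∀ a ∈ l, a ∈ S ∪ (fun a => a⁻¹) '' S}.Finite := by
      intro n
      have := hT.to_subtype
      have h2 := (List.finite_length_le (↥(S ∪ (fun a => a⁻¹) '' S)) n).image
        (fun l => l.map Subtype.val)
      refine h2.subset ?_
      rintro l ⟨hl, hm⟩
      refine ⟨l.pmap Subtype.mk hm, by simpa using hl, ?_⟩
      simp [List.map_pmap]
    refine ((hL ⌊r⌋₊).image List.prod).subset ?_
    intro x hx
    obtain ⟨l, hl, hp, hd⟩ := wdist_attained S hS 1 x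
    refine ⟨l, ⟨?_, ?_⟩, by simpa using hp⟩
    · apply Nat.le_floor
      rw [← hd]; exact hx
    · intro a ha
      rcases hl a ha with h | h
      · exact Or.inl h
      · exact Or.inr ⟨a⁻¹, h, by simp⟩

end WordMetric

/-! ### Hyperbolic geometry -/

section Hyp
variable {G : Type*} [Group G] {d : G → G → ℝ}

theorem WM.nonneg (hd : WM d) (x y : G) : 0 ≤ d x y := by
  have := hd.tri x y x
  rw [hd.self, hd.symm y x] at this
  linarith

theorem WM.finBall (hd : WM d) (p : G) (r : ℝ) : {x | d p x ≤ r}.Finite := by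
  refine ((hd.fin r).image (fun x => p * x)).subset ?_
  intro x hx
  refine ⟨p⁻¹ * x, ?_, by simp⟩
  have := hd.linv p⁻¹ p x
  simp only [inv_mul_cancel] at this
  simpa [this] using hx

theorem gpD_symm (hd : WM d) (w x y : G) : gpD d w x y = gpD d w y x := by
  unfold gpD; rw [hd.symm x y]; ring

theorem gpD_ge_sub (hd : WM d) (w x y : G) : d w x - d x y ≤ gpD d w x y := by
  unfold gpD
  have := hd.tri w y x
  rw [hd.symm y x] at this
  linarith

/-- change of base point -/
theorem gpD_base (hd : WM d) (w q x y : G) : gpD d w x y - d w q ≤ gpD d q x y := by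
  unfold gpD
  have h1 := hd.tri w q x
  have h2 := hd.tri w q y
  linarith

/-- perturbation of arguments -/
theorem gpD_pert (hd : WM d) (w x y x' y' : G) :
    gpD d w x y - d x x' - d y y' ≤ gpD d w x' y' := by
  unfold gpD
  have h1 := hd.tri w x' x
  have h2 := hd.tri w y' y
  have h3 := hd.tri x' x y'
  have h4 := hd.tri x y y'
  rw [hd.symm x' x] at *
  rw [hd.symm y' y] at *
  linarith

/-- a point with small Gromov product is close to any geodesic. -/
theorem near_geod (hd : WM d) {δ : ℝ} (hδ : DeltaHypD d δ) (hδ0 : 0 ≤ δ) {q x y : G} {k : ℝ}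
    (hk0 : 0 ≤ k) (hk : gpD d q x y ≤ k) {c : ℕ → G} {m : ℕ} (hm : (m : ℝ) = d x y)
    (hc : DiscGeodD d c m) (h0 : c 0 = x) (h1 : c m = y) :
    ∃ i ≤ m, d q (c i) ≤ 2 * k + 2 * δ := by
  obtain ⟨c', t, ht, -⟩ := hd.geod q x
  have hk' : d q x + d q y - d x y ≤ 2 * k := by unfold gpD at hk; linarith
  by_cases h : t ≤ m
  · refine ⟨t, h, ?_⟩
    have e1 : d x (c t) = t := by
      rw [← h0, hc 0 (Nat.zero_le _) t h]; simp
    have e2 : d (c t) y = m - t := by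
      rw [← h1, hc t h m le_rfl, abs_sub_comm, abs_of_nonneg]
      have : (t : ℝ) ≤ m := by exact_mod_cast h
      linarith
    have h4 := hδ (c t) x q y
    unfold gpD at h4
    rw [hd.symm (c t) x, hd.symm (c t) q, e1, e2] at h4
    rw [hd.symm x q] at h4
    have : d q (c t) / 2 - k ≤ min ((↑t + d q (c t) - d q x) / 2) ((d q (c t) + (↑m - ↑t) - d q y) / 2) := by
      apply le_min <;> linarith
    linarith
  · refine ⟨m, le_rfl, ?_⟩
    rw [h1]
    have : (m : ℝ) ≤ t := by exact_mod_cast (le_of_not_ge h)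
    linarith

/-- `A` is quasiconvex in the form used below. -/
def QCA (d : G → G → ℝ) (C : ℝ) (A : Set G) : Prop :=
  ∀ (c : ℕ → G) (m : ℕ), DiscGeodD d c m → c 0 ∈ A → c m ∈ A →
    ∀ i, i ≤ m → ∃ a ∈ A, d (c i) a ≤ C

theorem QCA_coset {C : ℝ} (hd : WM d) {H : Subgroup G} (h : QCSetD d C (H : Set G)) (g : G) :
    QCA d (C + 1) (cosetSet H g) := by
  intro c m hc h0 h1 i hi
  have := h (fun i => g⁻¹ * c i) m (by intro i hi j hj; rw [hd.linv]; exact hc i hi j hj) h0 h1 i hi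
  unfold pdistD at this
  obtain ⟨r, ⟨a, ha, rfl⟩, hr⟩ := exists_lt_of_csInf_lt
    (s := {r | ∃ a ∈ (H : Set G), r = d (g⁻¹ * c i) a}) ⟨_, 1, H.one_mem, rfl⟩
    (lt_of_le_of_lt this (lt_add_one C))
  refine ⟨g * a, by simpa [cosetSet] using ha, ?_⟩
  have e := hd.linv g (g⁻¹ * c i) a
  rw [mul_inv_cancel_left] at e
  rw [e]; exact hr.le

theorem near_QC (hd : WM d) {δ : ℝ} (hδ : DeltaHypD d δ) (hδ0 : 0 ≤ δ) {q x y : G} {k C : ℝ}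
    (hk0 : 0 ≤ k) (hk : gpD d q x y ≤ k) {A : Set G} (hA : QCA d C A) (hx : x ∈ A) (hy : y ∈ A) :
    ∃ a ∈ A, d q a ≤ 2 * k + 2 * δ + C := by
  obtain ⟨c, m, hm, hc, h0, h1⟩ := hd.geod x y
  obtain ⟨i, hi, hq⟩ := near_geod hd hδ hδ0 hk0 hk hm hc h0 h1
  obtain ⟨a, ha, haC⟩ := hA c m hc (h0 ▸ hx) (h1 ▸ hy) i hi
  refine ⟨a, ha, ?_⟩
  have := hd.tri q (c i) a
  linarith

/-- a point on a geodesic `[x,y]` far from the ends is near a quasiconvex set whose points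
fellow-travel the endpoints. -/
theorem deep_near (hd : WM d) {δ : ℝ} (hδ : DeltaHypD d δ) (hδ0 : 0 ≤ δ) {q x y a b : G} {C : ℝ}
    (h : gpD d q x y ≤ 0) (ha : δ < gpD d q x a) (hb : 2 * δ < gpD d q y b)
    {A : Set G} (hA : QCA d C A) (hx : a ∈ A) (hy : b ∈ A) :
    ∃ z ∈ A, d q z ≤ 6 * δ + C := by
  have h1 := hδ q x a y
  have h2 := hδ q a b y
  have e : gpD d q a y ≤ δ := by
    by_contra hcon
    have : δ < min (gpD d q x a) (gpD d q a y) := lt_min ha (not_le.1 hcon)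
    linarith
  have e2 : gpD d q a b ≤ 2 * δ := by
    by_contra hcon
    rw [gpD_symm hd q b y] at h2
    have : 2 * δ < min (gpD d q a b) (gpD d q y b) := lt_min (not_le.1 hcon) hb
    linarith
  obtain ⟨z, hz, hq⟩ := near_QC hd hδ hδ0 (by linarith) e2 hA hx hy
  exact ⟨z, hz, by linarith⟩

end Hyp

/-! ### The boundary -/

section Bdry
variable {G : Type*} [Group G] {d : G → G → ℝ}

/-- asymptoticity of sequences, elementary form. -/
def Cv (d : G → G → ℝ) (s t : ℕ → G) : Prop :=
  ∀ b : ℝ, ∃ N : ℕ, ∀ m ≥ N, ∀ n ≥ N, b ≤ gpD d 1 (s m) (t n)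

theorem cv_iff (s t : ℕ → G) :
    Tendsto (fun p : ℕ × ℕ => gpD d 1 (s p.1) (t p.2)) atTop atTop ↔ Cv d s t := by
  rw [tendsto_atTop_atTop]
  constructor
  · intro h b
    obtain ⟨i, hi⟩ := h b
    exact ⟨max i.1 i.2, fun m hm n hn =>
      hi (m, n) ⟨le_trans (le_max_left _ _) hm, le_trans (le_max_right _ _) hn⟩⟩
  · intro h b
    obtain ⟨N, hN⟩ := h b
    exact ⟨(N, N), fun a ha => hN a.1 ha.1 a.2 ha.2⟩

theorem Cv.symm (hd : WM d) {s t : ℕ → G} (h : Cv d s t) : Cv d t s := by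
  intro b
  obtain ⟨N, hN⟩ := h b
  exact ⟨N, fun m hm n hn => by rw [gpD_symm hd]; exact hN n hn m hm⟩

theorem Cv.trans {δ : ℝ} (hδ : DeltaHypD d δ) {s t u : ℕ → G} (h : Cv d s t) (h' : Cv d t u) :
    Cv d s u := by
  intro b
  obtain ⟨N, hN⟩ := h (b + δ)
  obtain ⟨N', hN'⟩ := h' (b + δ)
  refine ⟨max N N', fun m hm n hn => ?_⟩
  have h1 := hN m (le_trans (le_max_left _ _) hm) (max N N') (le_max_left _ _)
  have h2 := hN' (max N N') (le_max_right _ _) n (le_trans (le_max_right _ _) hn)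
  have h3 := hδ 1 (s m) (t (max N N')) (u n)
  have := le_min h1 h2
  linarith

theorem Cv.diag {s t : ℕ → G} (h : Cv d s t) (b : ℝ) :
    ∀ᶠ n in atTop, b ≤ gpD d 1 (s n) (t n) := by
  obtain ⟨N, hN⟩ := h b
  filter_upwards [eventually_ge_atTop N] with n hn using hN n hn n hn

theorem convTo_self {s : ℕ → G} {ξ : BdryD d 1} (h : ConvTo d 1 s ξ) : Cv d s s := by
  obtain ⟨hs, -⟩ := h
  exact (cv_iff s s).1 hs

theorem convTo_cv (hd : WM d) {δ : ℝ} (hδ : DeltaHypD d δ) {s t : ℕ → G} {ξ : BdryD d 1}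
    (h : ConvTo d 1 s ξ) (h' : ConvTo d 1 t ξ) : Cv d s t := by
  obtain ⟨hs, es⟩ := h
  obtain ⟨ht, et⟩ := h'
  have e := es.trans et.symm
  have e2 := Quot.eqvGen_exact e
  have key : ∀ a b : {u : ℕ → G // GromovSeqD d 1 u}, Relation.EqvGen (bdryRelD d 1) a b →
      Cv d a.1 b.1 := by
    intro a b hab
    induction hab with
    | rel a b h => exact (cv_iff _ _).1 h
    | refl a => exact (cv_iff _ _).1 a.2
    | symm a b _ ih => exact ih.symm hd
    | trans a b c _ _ ih1 ih2 => exact ih1.trans hδ ih2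
  exact key _ _ e2

theorem cv_convTo {s t : ℕ → G} {ξ : BdryD d 1}
    (h : ConvTo d 1 s ξ) (hst : Cv d s t) (ht : Cv d t t) : ConvTo d 1 t ξ := by
  obtain ⟨hs, rfl⟩ := h
  exact ⟨(cv_iff _ _).2 ht, 
    (Quot.sound (r := bdryRelD d 1) (a := ⟨s, hs⟩) (b := ⟨t, (cv_iff _ _).2 ht⟩)
      ((cv_iff _ _).2 hst)).symm⟩

theorem cv_exists {s : ℕ → G} (h : Cv d s s) : ∃ ξ : BdryD d 1, ConvTo d 1 s ξ :=
  ⟨_, (cv_iff _ _).2 h, rfl⟩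

/-- diagonal extraction -/
theorem extract {ι : Type*} [Countable ι] (f : ℕ → ι → G) (F : ι → Set G)
    (hF : ∀ i, (F i).Finite) (hf : ∀ m i, f m i ∈ F i) :
    ∃ (ψ : ℕ → ℕ) (c : ι → G), StrictMono ψ ∧ ∀ i, ∀ᶠ m in atTop, f (ψ m) i = c i := by
  let _ : TopologicalSpace G := ⊥
  have : DiscreteTopology G := ⟨rfl⟩
  have hK : IsCompact (Set.pi Set.univ F) := isCompact_univ_pi (fun i => (hF i).isCompact)
  obtain ⟨c, -, ψ, hψ, ht⟩ := hK.tendsto_subseq (x := f) (fun m => fun i _ => hf m i)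
  refine ⟨ψ, c, hψ, fun i => ?_⟩
  have := (tendsto_pi_nhds.1 ht) i
  rw [nhds_discrete, tendsto_pure] at this
  exact this

theorem gromov_subseq (hd : WM d) (x : ℕ → G)
    (hx : Tendsto (fun m => d 1 (x m)) atTop atTop) :
    ∃ ψ : ℕ → ℕ, StrictMono ψ ∧ Cv d (x ∘ ψ) (x ∘ ψ) := by
  choose c L hL hc h0 h1 using fun m => hd.geod 1 (x m)
  have hone : ∀ m, ∀ T ≤ L m, d 1 (c m T) = T := by
    intro m T hT
    rw [← h0 m, hc m 0 (Nat.zero_le _) T hT]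
    simp
  have hend : ∀ m, ∀ T ≤ L m, d (c m T) (x m) = d 1 (x m) - T := by
    intro m T hT
    rw [← hL m, ← h1 m, hc m T hT (L m) le_rfl, abs_sub_comm, abs_of_nonneg]
    have : (T : ℝ) ≤ L m := by exact_mod_cast hT
    linarith
  obtain ⟨ψ, γ, hψ, hγ⟩ := extract (fun m (T : ℕ) => if T ≤ L m then c m T else 1)
    (fun T => {z | d 1 z ≤ T}) (fun T => hd.fin T) (by
      intro m T
      show d 1 _ ≤ _
      split_ifs with h
      · exact (hone m T h).le
      · rw [hd.self]; positivity)
  refine ⟨ψ, hψ, ?_⟩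
  intro b
  obtain ⟨T, hT⟩ := exists_nat_ge b
  have e1 := hγ T
  have e2 := (hx.comp hψ.tendsto_atTop).eventually_ge_atTop (T : ℝ)
  obtain ⟨N, hN⟩ := eventually_atTop.1 (e1.and e2)
  refine ⟨N, fun m hm n hn => hT.trans ?_⟩
  obtain ⟨a1, a2⟩ := hN m hm
  obtain ⟨b1, b2⟩ := hN n hn
  have la : T ≤ L (ψ m) := by
    have : (T : ℝ) ≤ L (ψ m) := by rw [hL]; exact a2
    exact_mod_cast this
  have lb : T ≤ L (ψ n) := by
    have : (T : ℝ) ≤ L (ψ n) := by rw [hL]; exact b2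
    exact_mod_cast this
  rw [if_pos la] at a1
  rw [if_pos lb] at b1
  have ea := hend _ T la
  have eb := hend _ T lb
  rw [a1] at ea
  rw [b1] at eb
  have ht := hd.tri (x (ψ m)) (γ T) (x (ψ n))
  rw [hd.symm _ (γ T)] at ht
  simp only [gpD, Function.comp]
  linarith

/-- points of the join are near the quasiconvex set. -/
theorem join_near (hd : WM d) {δ : ℝ} (hδ : DeltaHypD d δ) (hδ0 : 0 ≤ δ) {A : Set G} {C : ℝ}
    (hA : QCA d C A) {p : G} (hp : p ∈ joinD d 1 (limitSetD d 1 A)) :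
    ∃ a ∈ A, d p a ≤ 6 * δ + C := by
  obtain ⟨γ, hγ, ⟨⟨ξ, ⟨s, hs, hsξ⟩, hγξ⟩, ⟨η, ⟨t, ht, htη⟩, hγη⟩⟩, ⟨i, rfl⟩⟩ := hp
  have c1 := (convTo_cv hd hδ hγξ hsξ).diag (d 1 (γ i) + 2 * δ + 1)
  have c2 := (convTo_cv hd hδ hγη htη).diag (d 1 (γ i) + 2 * δ + 1)
  obtain ⟨n, h1, h2, h3⟩ := (c1.and (c2.and (eventually_ge_atTop i.natAbs))).exists
  have b1 := gpD_base hd 1 (γ i) (γ n) (s n)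
  have b2 := gpD_base hd 1 (γ i) (γ (-(n : ℤ))) (t n)
  refine deep_near hd hδ hδ0 (x := γ n) (y := γ (-(n : ℤ))) (a := s n) (b := t n) ?_ (by linarith)
    (by linarith) hA (hs n) (ht n)
  have hi1 : i ≤ n := by omega
  have hi2 : -(n : ℤ) ≤ i := by omega
  have hi1' : (i : ℝ) ≤ n := by exact_mod_cast hi1
  have hi2' : -(n : ℝ) ≤ i := by exact_mod_cast hi2
  unfold gpD
  rw [hγ, hγ, hγ]
  push_cast
  rw [abs_of_nonpos (by linarith : (i : ℝ) - n ≤ 0),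
    abs_of_nonneg (by linarith : 0 ≤ (i : ℝ) - -(n : ℝ)),
    abs_of_nonneg (by linarith : 0 ≤ (n : ℝ) - -(n : ℝ))]
  linarith

theorem cv_of_ray (hd : WM d) {γ : ℕ → G} (hγ : ∀ m n : ℕ, d (γ m) (γ n) = |(m : ℝ) - n|) :
    Cv d γ γ := by
  intro b
  obtain ⟨N, hN⟩ := exists_nat_ge (b + d (γ 0) 1)
  refine ⟨N, fun m hm n hn => ?_⟩
  have h := gpD_base hd (γ 0) 1 (γ m) (γ n)
  have hm' : (N : ℝ) ≤ m := by exact_mod_cast hm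
  have hn' : (N : ℝ) ≤ n := by exact_mod_cast hn
  have : (N : ℝ) ≤ gpD d (γ 0) (γ m) (γ n) := by
    unfold gpD
    rw [hγ, hγ, hγ]
    have e1 : |((0 : ℕ) : ℝ) - m| = m := by simp
    have e2 : |((0 : ℕ) : ℝ) - n| = n := by simp
    rw [e1, e2]
    rcases abs_cases ((m : ℝ) - n) with h | h <;> linarith
  linarith

theorem cv_pert (hd : WM d) {s t : ℕ → G} {K : ℝ} (h : Cv d s s) (hst : ∀ n, d (s n) (t n) ≤ K) :
    Cv d s t ∧ Cv d t t := by
  have hK : 0 ≤ K := (hd.nonneg _ _).trans (hst 0)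
  constructor
  · intro b
    obtain ⟨N, hN⟩ := h (b + K)
    refine ⟨N, fun m hm n hn => ?_⟩
    have h1 := hN m hm n hn
    have h2 := gpD_pert hd 1 (s m) (s n) (s m) (t n)
    have h3 := hst n
    rw [hd.self] at h2
    linarith
  · intro b
    obtain ⟨N, hN⟩ := h (b + 2 * K)
    refine ⟨N, fun m hm n hn => ?_⟩
    have h1 := hN m hm n hn
    have h2 := gpD_pert hd 1 (s m) (s n) (t m) (t n)
    have h3 := hst n
    have h4 := hst m
    linarith

theorem ray_end (hd : WM d) {γ : ℕ → G} (hγ : ∀ m n : ℕ, d (γ m) (γ n) = |(m : ℝ) - n|)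
    {A : Set G} {K : ℝ} (hA : ∀ n, ∃ a ∈ A, d (γ n) a ≤ K) :
    ∃ ξ ∈ limitSetD d 1 A, ConvTo d 1 γ ξ := by
  have h := cv_of_ray hd hγ
  obtain ⟨ξ, hξ⟩ := cv_exists h
  choose t ht hK using hA
  obtain ⟨h1, h2⟩ := cv_pert hd h hK
  exact ⟨ξ, ⟨t, ht, cv_convTo hξ h1 h2⟩, hξ⟩

theorem line_join (hd : WM d) {γ : ℤ → G} (hγ : DiscLineD d γ)
    {A : Set G} {K : ℝ} (hA : ∀ n, ∃ a ∈ A, d (γ n) a ≤ K) (i : ℤ) :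
    γ i ∈ joinD d 1 (limitSetD d 1 A) := by
  refine ⟨γ, hγ, ⟨?_, ?_⟩, ⟨i, rfl⟩⟩
  · refine ray_end hd (K := K) ?_ ?_
    · intro m n; rw [hγ]; push_cast; rfl
    · intro n; exact hA _
  · refine ray_end hd (K := K) ?_ ?_
    · intro m n; rw [hγ]; push_cast
      rw [abs_sub_comm]; congr 1; ring
    · intro n; exact hA _

theorem line_exists (hd : WM d) {H : Subgroup G} (hinf : (H : Set G).Infinite) {C : ℝ}
    (hC0 : 0 ≤ C) (hC : QCA d C (H : Set G)) :
    ∃ γ : ℤ → G, DiscLineD d γ ∧ ∀ i, ∃ h ∈ H, d (γ i) h ≤ C := by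
  have hex : ∀ m : ℕ, ∃ g : ℤ → G, (∀ i j : ℤ, i.natAbs ≤ m → j.natAbs ≤ m →
      d (g i) (g j) = |(i : ℝ) - j|) ∧ (∀ i : ℤ, i.natAbs ≤ m → ∃ h ∈ H, d (g i) h ≤ C) ∧
      d 1 (g 0) ≤ C := by
    intro m
    obtain ⟨h, hH, hfar⟩ := hinf.exists_notMem_finite (hd.fin (2 * m))
    have hfar : 2 * (m : ℝ) < d 1 h := not_le.1 hfar
    obtain ⟨c, L, hL, hc, h0, h1⟩ := hd.geod 1 h
    have hLm : 2 * m ≤ L := by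
      rw [← hL] at hfar
      exact_mod_cast hfar.le
    have hnear := hC c L hc (by rw [h0]; exact H.one_mem) (by rw [h1]; exact hH)
    obtain ⟨a, ha, hda⟩ := hnear m (by omega)
    refine ⟨fun i => a⁻¹ * c (i + m).toNat, ?_, ?_, ?_⟩
    · intro i j hi hj
      rw [hd.linv, hc _ (by omega) _ (by omega)]
      have e1 : (((i + m).toNat : ℤ) : ℝ) = ((i + m : ℤ) : ℝ) := by
        rw [Int.toNat_of_nonneg (by omega)]
      have e2 : (((j + m).toNat : ℤ) : ℝ) = ((j + m : ℤ) : ℝ) := by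
        rw [Int.toNat_of_nonneg (by omega)]
      push_cast at e1 e2
      rw [e1, e2]
      congr 1; ring
    · intro i hi
      obtain ⟨b, hb, hdb⟩ := hnear (i + m).toNat (by omega)
      exact ⟨a⁻¹ * b, H.mul_mem (H.inv_mem ha) hb, by rw [hd.linv]; exact hdb⟩
    · have := hd.linv a⁻¹ a (c m)
      rw [inv_mul_cancel] at this
      simp only [zero_add, Int.toNat_natCast]
      rw [this, hd.symm]; exact hda
  choose g hg1 hg2 hg3 using hex
  obtain ⟨ψ, γ, hψ, hγ⟩ := extract (fun m (i : ℤ) => if i.natAbs ≤ m then g m i else 1)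
    (fun i => {z | d 1 z ≤ C + |(i : ℝ)|}) (fun i => hd.fin _) (by
      intro m i
      show d 1 _ ≤ _
      split_ifs with h
      · have h1 := hg1 m 0 i (by simp) h
        have h2 := hd.tri 1 (g m 0) (g m i)
        have h3 := hg3 m
        simp at h1
        linarith
      · rw [hd.self]; positivity)
  have hev : ∀ i : ℤ, ∀ᶠ m in atTop, i.natAbs ≤ ψ m ∧ g (ψ m) i = γ i := by
    intro i
    filter_upwards [hγ i, hψ.tendsto_atTop.eventually_ge_atTop i.natAbs] with m h1 h2
    rw [if_pos h2] at h1
    exact ⟨h2, h1⟩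
  refine ⟨γ, ?_, ?_⟩
  · intro i j
    obtain ⟨m, ⟨h1, h2⟩, ⟨h3, h4⟩⟩ := ((hev i).and (hev j)).exists
    rw [← h2, ← h4]
    exact hg1 _ i j h1 h3
  · intro i
    obtain ⟨m, h1, h2⟩ := (hev i).exists
    rw [← h2]
    exact hg2 _ i h1

theorem coset_near_join (hd : WM d) {H : Subgroup G} (hinf : (H : Set G).Infinite) {C : ℝ}
    (hC0 : 0 ≤ C) (hC : QCA d C (H : Set G)) (g x : G) (hx : x ∈ cosetSet H g) :
    ∃ p ∈ joinD d 1 (limitSetD d 1 (cosetSet H g)), d x p ≤ C := by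
  obtain ⟨γ, hγ, hn⟩ := line_exists hd hinf hC0 hC
  obtain ⟨a, ha, hda⟩ := hn 0
  refine ⟨x * a⁻¹ * γ 0, ?_, ?_⟩
  · refine line_join hd (γ := fun i => x * a⁻¹ * γ i) (K := C) ?_ ?_ 0
    · intro i j; rw [hd.linv]; exact hγ i j
    · intro i
      obtain ⟨b, hb, hdb⟩ := hn i
      refine ⟨x * a⁻¹ * b, ?_, by rw [hd.linv]; exact hdb⟩
      have : g⁻¹ * (x * a⁻¹ * b) = g⁻¹ * x * (a⁻¹ * b) := by group
      show g⁻¹ * (x * a⁻¹ * b) ∈ H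
      rw [this]
      exact H.mul_mem hx (H.mul_mem (H.inv_mem ha) hb)
  · have := hd.linv (x * a⁻¹) a (γ 0)
    rw [inv_mul_cancel_right] at this
    rw [this, hd.symm]; exact hda

theorem limit_finite (A : Set G) (hA : A.Finite) (hd : WM d) : limitSetD d 1 A = ∅ := by
  rw [Set.eq_empty_iff_forall_notMem]
  rintro ξ ⟨s, hs, hξ⟩
  obtain ⟨B, hB⟩ := (hA.image (d 1)).bddAbove
  obtain ⟨n, hn⟩ := ((convTo_self hξ).diag (B + 1)).exists
  have h2 : d 1 (s n) ≤ B := hB ⟨_, hs n, rfl⟩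
  unfold gpD at hn
  rw [hd.self] at hn
  linarith

/-- points far out that are near all members of a family with a common limit point. -/
theorem deep_points (hd : WM d) {δ : ℝ} (hδ : DeltaHypD d δ) (hδ0 : 0 ≤ δ) {ι : Type*}
    {A : ι → Set G} {C : ℝ} (hA : ∀ i, QCA d C (A i)) {σ : Set ι} (hσ : σ.Finite)
    (hne : σ.Nonempty) {ξ : BdryD d 1} (hξ : ∀ i ∈ σ, ξ ∈ limitSetD d 1 (A i)) :
    ∃ T0 : ℕ, ∀ T : ℕ, T0 ≤ T → ∃ p, d 1 p = T ∧ ∀ i ∈ σ, ∃ a ∈ A i, d p a ≤ 10 * δ + C := by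
  obtain ⟨i0, hi0⟩ := hne
  have hξ' : ∀ i, ∃ s : ℕ → G, i ∈ σ → ((∀ n, s n ∈ A i) ∧ ConvTo d 1 s ξ) := by
    intro i
    by_cases h : i ∈ σ
    · obtain ⟨s, h1, h2⟩ := hξ i h
      exact ⟨s, fun _ => ⟨h1, h2⟩⟩
    · exact ⟨fun _ => 1, fun h' => absurd h' h⟩
  choose s hs using hξ'
  obtain ⟨B, hB⟩ := (hσ.image (fun i => d 1 (s i 0))).bddAbove
  obtain ⟨T0, hT0⟩ := exists_nat_ge (B + δ + 1)
  refine ⟨T0, fun T hT => ?_⟩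
  have hT' : (T0 : ℝ) ≤ T := by exact_mod_cast hT
  have hev : ∀ᶠ n in atTop, ∀ i ∈ σ, ∀ j ∈ σ, (T : ℝ) + 2 * δ + 1 ≤ gpD d 1 (s i n) (s j n) := by
    rw [eventually_all_finite hσ]
    intro i hi
    rw [eventually_all_finite hσ]
    intro j hj
    exact (convTo_cv hd hδ (hs i hi).2 (hs j hj).2).diag _
  obtain ⟨n, hn⟩ := hev.exists
  have hq : ∀ i ∈ σ, ∃ q, d 1 q = T ∧ d q (s i n) = d 1 (s i n) - T ∧
      ∃ a ∈ A i, d q a ≤ 6 * δ + C := by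
    intro i hi
    obtain ⟨c, L, hL, hc, h0, h1⟩ := hd.geod 1 (s i n)
    have hnn := hn i hi i hi
    have hLn : (T : ℝ) + 2 * δ + 1 ≤ L := by
      unfold gpD at hnn
      rw [hd.self] at hnn
      rw [hL]; linarith
    have hTL' : (T : ℝ) ≤ L := by linarith
    have hTL : T ≤ L := by exact_mod_cast hTL'
    have e1 : d 1 (c T) = T := by
      rw [← h0, hc 0 (Nat.zero_le _) T hTL]; simp
    have e2 : d (c T) (s i n) = d 1 (s i n) - T := by
      rw [← hL, ← h1, hc T hTL L le_rfl, abs_sub_comm, abs_of_nonneg]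
      linarith
    refine ⟨c T, e1, e2, ?_⟩
    have hb0 : d 1 (s i 0) ≤ B := hB ⟨i, hi, rfl⟩
    refine deep_near hd hδ hδ0 (x := 1) (y := s i n) (a := s i 0) (b := s i n) ?_ ?_ ?_ (hA i)
      ((hs i hi).1 0) ((hs i hi).1 n)
    · unfold gpD
      rw [e2, hd.symm _ 1, e1]; linarith
    · have := gpD_ge_sub hd (c T) 1 (s i 0)
      rw [hd.symm _ 1, e1] at this
      linarith
    · unfold gpD
      rw [hd.self, e2, ← hL]
      linarith
  obtain ⟨p, hp1, hp2, -⟩ := hq i0 hi0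
  refine ⟨p, hp1, fun i hi => ?_⟩
  obtain ⟨q, hq1, hq2, a, ha, hqa⟩ := hq i hi
  refine ⟨a, ha, ?_⟩
  have hpq : d p q ≤ 4 * δ := by
    have g1 : gpD d 1 p (s i0 n) = T := by unfold gpD; rw [hp1, hp2]; ring
    have g2 : gpD d 1 (s i n) q = T := by rw [gpD_symm hd]; unfold gpD; rw [hq1, hq2]; ring
    have g3 := hn i0 hi0 i hi
    have m1 := hδ 1 p (s i0 n) (s i n)
    have m2 := hδ 1 p (s i n) q
    rw [g1] at m1
    rw [g2] at m2
    have l1 : (T : ℝ) ≤ min (T : ℝ) (gpD d 1 (s i0 n) (s i n)) := le_min le_rfl (by linarith)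
    have l2 : (T : ℝ) - δ ≤ min (gpD d 1 p (s i n)) (T : ℝ) := le_min (by linarith) (by linarith)
    have l3 : (T : ℝ) - 2 * δ ≤ gpD d 1 p q := by linarith
    unfold gpD at l3
    rw [hp1, hq1] at l3
    linarith
  have := hd.tri p q a
  linarith

end Bdry

/-! ### Families of cosets -/

section Cosets
variable {G : Type*} [Group G] {d : G → G → ℝ}

theorem reps_eq {H : Subgroup G} {R : Set G} (hR : IsCosetReps H R) {x : G} {r s : R}
    (hr : x ∈ cosetSet H (r : G)) (hs : x ∈ cosetSet H (s : G)) : r = s := by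
  obtain ⟨t, -, ht⟩ := hR x
  have h1 := ht r ⟨r.2, by
    have h := H.inv_mem hr
    simpa using h⟩
  have h2 := ht s ⟨s.2, by
    have h := H.inv_mem hs
    simpa using h⟩
  exact Subtype.ext (h1.trans h2.symm)

theorem reps_exists {H : Subgroup G} {R : Set G} (hR : IsCosetReps H R) (x : G) :
    ∃ r : R, x ∈ cosetSet H (r : G) := by
  obtain ⟨t, ⟨h1, h2⟩, -⟩ := hR x
  refine ⟨⟨t, h1⟩, ?_⟩
  have h := H.inv_mem h2
  show t⁻¹ * x ∈ H
  simpa using h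

theorem reps_infinite {H : Subgroup G} {R : Set G} (hR : IsCosetReps H R)
    (hinf : Infinite (G ⧸ H)) : Infinite R := by
  refine Infinite.of_surjective (fun r : R => (QuotientGroup.mk (r : G) : G ⧸ H)) ?_
  intro q
  obtain ⟨g, rfl⟩ := QuotientGroup.mk_surjective q
  obtain ⟨r, hr⟩ := reps_exists hR g
  exact ⟨r, QuotientGroup.eq.2 hr⟩

theorem card_bound (hd : WM d) {H : Subgroup G} {R : Set G} (hR : IsCosetReps H R) (K : ℝ)
    (p : G) (σ : Finset R) (h : ∀ r ∈ σ, ∃ a ∈ cosetSet H (r : G), d p a ≤ K) :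
    σ.card ≤ (hd.fin K).toFinset.card := by
  have h' : ∀ r : R, ∃ a : G, r ∈ σ → a ∈ cosetSet H (r : G) ∧ d p a ≤ K := by
    intro r
    by_cases hr : r ∈ σ
    · obtain ⟨a, h1, h2⟩ := h r hr
      exact ⟨a, fun _ => ⟨h1, h2⟩⟩
    · exact ⟨1, fun h => absurd h hr⟩
  choose a ha using h'
  refine Finset.card_le_card_of_injOn (fun r => p⁻¹ * a r) ?_ ?_
  · intro r hr
    simp only [Set.Finite.coe_toFinset, Set.mem_setOf_eq]
    have := hd.linv p⁻¹ p (a r)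
    rw [inv_mul_cancel] at this
    rw [this]
    exact (ha r hr).2
  · intro r hr s hs hrs
    have : a r = a s := mul_left_cancel hrs
    have h1 := (ha r hr).1
    rw [this] at h1
    exact reps_eq hR h1 (ha s hs).1

theorem inf_many (hd : WM d) {δ : ℝ} (hδ : DeltaHypD d δ) (hδ0 : 0 ≤ δ)
    {H : Subgroup G} {R : Set G} (hR : IsCosetReps H R) (hRinf : Infinite R) {C : ℝ}
    (hA : ∀ g, QCA d C (cosetSet H g)) {σ : Set R} (hσ : σ.Finite) (hne : σ.Nonempty)
    {ξ : BdryD d 1} (hξ : ∀ r ∈ σ, ξ ∈ limitSetD d 1 (cosetSet H (r : G))) :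
    ∃ N : ℝ, {s : R | ∀ r ∈ σ, ∃ x ∈ cosetSet H (r : G), ∃ y ∈ cosetSet H (s : G),
      d x y ≤ N}.Infinite := by
  obtain ⟨T0, hT0⟩ := deep_points hd hδ hδ0 (A := fun r : R => cosetSet H (r : G))
    (fun r => hA r) hσ hne hξ
  choose p hp1 hp2 using fun T : ℕ => hT0 (T0 + T) (Nat.le_add_right _ _)
  choose rep hrep using reps_exists hR
  by_contra hcon
  push Not at hcon
  have hfin : ∀ b : G, (Set.range (fun T => rep (p T * b))).Finite := by
    intro b
    refine (hcon (10 * δ + C + d 1 b)).subset ?_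
    rintro s ⟨T, rfl⟩ r hr
    obtain ⟨a, ha, hpa⟩ := hp2 T r hr
    refine ⟨a, ha, p T * b, hrep _, ?_⟩
    have h1 := hd.tri a (p T) (p T * b)
    have h2 := hd.linv (p T) 1 b
    rw [mul_one] at h2
    rw [hd.symm a (p T)] at h1
    linarith
  obtain ⟨B, hB⟩ := Infinite.exists_subset_card_eq R ((hd.fin (6 * δ + C)).toFinset.card + 1)
  have hrange : (Set.range (fun T => fun b : B => rep (p T * (b : R)))).Finite := by
    refine (Set.Finite.pi (fun b : B => hfin ((b : R) : G))).subset ?_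
    rintro _ ⟨T, rfl⟩ b -
    exact ⟨T, rfl⟩
  have hfiber : ∃ v, {T | (fun b : B => rep (p T * (b : R))) = v}.Infinite := by
    by_contra hc
    push Not at hc
    have h1 := hrange.preimage' (f := (fun T => fun b : B => rep (p T * (b : R))))
      (fun v _ => hc v)
    rw [Set.preimage_range] at h1
    exact Set.infinite_univ h1
  obtain ⟨v, hv⟩ := hfiber
  obtain ⟨T, hT⟩ := hv.nonempty
  obtain ⟨D, hD⟩ := (B.finite_toSet.image (fun b : R => d 1 (b : G))).bddAbove
  obtain ⟨t, ht⟩ := exists_nat_gt (D + 2 * δ)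
  obtain ⟨T', hT', hlt⟩ := hv.exists_gt (T + 2 * t)
  set y := (p T)⁻¹ * p T' with hy
  have hyb : ∀ b ∈ B, y * (b : G) ∈ cosetSet H (b : G) := by
    intro b hb
    have e : rep (p T * b) = rep (p T' * b) := by
      have h1 := congrFun hT ⟨b, hb⟩
      have h2 := congrFun hT' ⟨b, hb⟩
      exact h1.trans h2.symm
    have h1 := hrep (p T * b)
    have h2 := hrep (p T' * b)
    rw [← e] at h2
    have h3 := H.mul_mem (H.inv_mem h1) h2
    have e3 : ((rep (p T * b) : G)⁻¹ * (p T * b))⁻¹ * ((rep (p T * b) : G)⁻¹ * (p T' * b)) =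
        (b : G)⁻¹ * (y * b) := by rw [hy]; group
    rw [e3] at h3
    exact h3
  have hylen : 2 * (t : ℝ) < d 1 y := by
    have h1 := hd.linv (p T) 1 y
    rw [hy, mul_one, mul_inv_cancel_left] at h1
    have h2 := hd.tri 1 (p T) (p T')
    rw [hp1, hp1] at h2
    have h3 : ((T + 2 * t : ℕ) : ℝ) < T' := by exact_mod_cast hlt
    push_cast at h2 h3
    rw [← hy] at h1
    linarith
  obtain ⟨c, L, hL, hc, h0, h1⟩ := hd.geod 1 y
  rw [← hL] at hylen
  have htL : t ≤ L := by
    have : 2 * t < L := by exact_mod_cast hylen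
    omega
  have e1 : d (c t) 1 = t := by
    rw [hd.symm, ← h0, hc 0 (Nat.zero_le _) t htL]; simp
  have e2 : d (c t) y = L - t := by
    rw [← h1, hc t htL L le_rfl, abs_sub_comm, abs_of_nonneg]
    have : (t : ℝ) ≤ L := by exact_mod_cast htL
    linarith
  have := card_bound hd hR (6 * δ + C) (c t) B (by
    intro b hb
    have hbD : d 1 (b : G) ≤ D := hD ⟨b, hb, rfl⟩
    refine deep_near hd hδ hδ0 (x := 1) (y := y) (a := b) (b := y * b) ?_ ?_ ?_ (hA b) ?_ (hyb b hb)
    · unfold gpD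
      rw [e1, e2, ← hL]; linarith
    · have := gpD_ge_sub hd (c t) 1 (b : G)
      linarith
    · have := gpD_ge_sub hd (c t) y (y * b)
      have h2 := hd.linv y 1 (b : G)
      rw [mul_one] at h2
      linarith
    · show (b : G)⁻¹ * b ∈ H
      rw [inv_mul_cancel]; exact H.one_mem)
  omega

theorem inter_of_inf (hd : WM d) {δ : ℝ} (hδ : DeltaHypD d δ) (hδ0 : 0 ≤ δ)
    {H : Subgroup G} {R : Set G} (hR : IsCosetReps H R) {C : ℝ}
    (hA : ∀ g, QCA d C (cosetSet H g)) {σ : Set R} (hne : σ.Nonempty) {N : ℝ}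
    (hinf : {s : R | ∀ r ∈ σ, ∃ x ∈ cosetSet H (r : G), ∃ y ∈ cosetSet H (s : G),
      d x y ≤ N}.Infinite) :
    ∃ ξ : BdryD d 1, ∀ r ∈ σ, ξ ∈ limitSetD d 1 (cosetSet H (r : G)) := by
  obtain ⟨r0, hr0⟩ := hne
  set u := hinf.natEmbedding with hu
  have hu2 : ∀ m, ∀ r : R, ∃ x y : G, r ∈ σ → (x ∈ cosetSet H (r : G) ∧
      y ∈ cosetSet H ((u m : R) : G) ∧ d x y ≤ N) := by
    intro m r
    by_cases hr : r ∈ σ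
    · obtain ⟨x, hx, y, hy, hxy⟩ := (u m).2 r hr
      exact ⟨x, y, fun _ => ⟨hx, hy, hxy⟩⟩
    · exact ⟨1, 1, fun h => absurd h hr⟩
  choose x y hxy using hu2
  have hfar : ∀ T : ℝ, ∀ᶠ m in atTop, ∀ z ∈ cosetSet H ((u m : R) : G), T < d 1 z := by
    intro T
    have hf : {m | ∃ z ∈ cosetSet H ((u m : R) : G), d 1 z ≤ T}.Finite := by
      have hz : ∀ m, ∃ z, (∃ z ∈ cosetSet H ((u m : R) : G), d 1 z ≤ T) →
          z ∈ cosetSet H ((u m : R) : G) ∧ d 1 z ≤ T := by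
        intro m
        by_cases h : ∃ z ∈ cosetSet H ((u m : R) : G), d 1 z ≤ T
        · obtain ⟨z, h1, h2⟩ := h
          exact ⟨z, fun _ => ⟨h1, h2⟩⟩
        · exact ⟨1, fun h' => absurd h' h⟩
      choose z hz using hz
      refine Set.Finite.of_injOn (f := z) (t := {z | d 1 z ≤ T}) ?_ ?_ (hd.fin T)
      · intro m hm
        exact (hz m hm).2
      · intro m hm n hn hmn
        have h1 := (hz m hm).1
        rw [hmn] at h1
        exact u.injective (Subtype.ext (reps_eq hR h1 (hz n hn).1))
    have := hf.eventually_cofinite_notMem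
    rw [Nat.cofinite_eq_atTop] at this
    filter_upwards [this] with m hm z hz
    by_contra hcon
    exact hm ⟨z, hz, not_lt.1 hcon⟩
  have hgp : ∀ r ∈ σ, ∀ r' ∈ σ, ∀ b : ℝ, ∀ᶠ m in atTop, b ≤ gpD d 1 (x m r) (x m r') := by
    intro r hr r' hr' b
    filter_upwards [hfar (2 * max 0 (b + 2 * N) + 2 * δ + C)] with m hm
    obtain ⟨-, h2, h3⟩ := hxy m r hr
    obtain ⟨-, h2', h3'⟩ := hxy m r' hr'
    have key : b + 2 * N ≤ gpD d 1 (y m r) (y m r') := by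
      by_contra hcon
      obtain ⟨a, ha, hda⟩ := near_QC hd hδ hδ0 (q := 1) (le_max_left 0 (b + 2 * N))
        ((not_le.1 hcon).le.trans (le_max_right _ _)) (hA _) h2 h2'
      have := hm a ha
      linarith
    have hp := gpD_pert hd 1 (y m r) (y m r') (x m r) (x m r')
    rw [hd.symm (y m r), hd.symm (y m r')] at hp
    linarith
  have hto : Tendsto (fun m => d 1 (x m r0)) atTop atTop := by
    rw [Filter.tendsto_atTop]
    intro b
    filter_upwards [hgp r0 hr0 r0 hr0 b] with m hm
    unfold gpD at hm
    rw [hd.self] at hm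
    linarith
  obtain ⟨ψ, hψ, hcv⟩ := gromov_subseq hd (fun m => x m r0) hto
  obtain ⟨ξ, hξ⟩ := cv_exists hcv
  refine ⟨ξ, fun r hr => ⟨fun m => x (ψ m) r, fun m => (hxy _ r hr).1, ?_⟩⟩
  have h1 : Cv d ((fun m => x m r0) ∘ ψ) (fun m => x (ψ m) r) := by
    intro b
    obtain ⟨N1, hN1⟩ := hcv (b + δ)
    obtain ⟨N2, hN2⟩ := eventually_atTop.1
      (hψ.tendsto_atTop.eventually (hgp r0 hr0 r hr (b + δ)))
    refine ⟨max N1 N2, fun m hm n hn => ?_⟩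
    have a1 := hN1 m (le_trans (le_max_left _ _) hm) n (le_trans (le_max_left _ _) hn)
    have a2 := hN2 n (le_trans (le_max_right _ _) hn)
    have a3 := hδ 1 (x (ψ m) r0) (x (ψ n) r0) (x (ψ n) r)
    have := le_min a1 a2
    simp only [Function.comp] at *
    linarith
  exact cv_convTo hξ h1 ((h1.symm hd).trans hδ h1)

end Cosets

/-! ### Comparison with joins and the main theorem -/

section Main
variable {G : Type*} [Group G]

theorem setDist_le {α : Type*} {d : α → α → ℝ} (h0 : ∀ x y, 0 ≤ d x y) {A B : Set α} {a b : α}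
    (ha : a ∈ A) (hb : b ∈ B) : setDistD d A B ≤ d a b := by
  apply csInf_le
  · refine ⟨0, ?_⟩
    rintro r ⟨x, -, y, -, rfl⟩
    exact h0 x y
  · exact ⟨a, ha, b, hb, rfl⟩

/-- All that is needed about one group. -/
structure Pkg (S : Set G) (H : Subgroup G) (R : Set G) : Prop where
  fwd : ∀ σ : Set R, σ.Finite → σ.Nonempty →
    (⋂ r ∈ σ, cosetLimitSet S H (r : G)).Nonempty →
    (H : Set G).Infinite ∧ ∃ N : ℕ, {s : R | ∀ r ∈ σ,
      setDistD (wdist S) (cosetJoin S H (r : G)) (cosetJoin S H (s : G)) ≤ N}.Infinite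
  bwd : (H : Set G).Infinite → ∀ σ : Set R, σ.Nonempty → ∀ N : ℕ, {s : R | ∀ r ∈ σ,
      setDistD (wdist S) (cosetJoin S H (r : G)) (cosetJoin S H (s : G)) ≤ N}.Infinite →
    (⋂ r ∈ σ, cosetLimitSet S H (r : G)).Nonempty
  width : ∃ M : ℕ, ∀ σ : Finset R, (⋂ r ∈ (σ : Set R), cosetLimitSet S H (r : G)).Nonempty →
    σ.card ≤ M
  inf : Infinite R
  triv : ¬ (H : Set G).Infinite → ∀ r s : R,
    setDistD (wdist S) (cosetJoin S H (r : G)) (cosetJoin S H (s : G)) = 0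

theorem pkg (S : Set G) (hfin : S.Finite) (hS : Subgroup.closure S = ⊤) (hhyp : HypD (wdist S))
    (H : Subgroup G) (hqc : QCSubgroup S H) (hinf : Infinite (G ⧸ H)) (R : Set G)
    (hR : IsCosetReps H R) : Pkg S H R := by
  have hd := wdist_WM S hfin hS
  obtain ⟨δ, hδ0, hδ⟩ := hhyp
  obtain ⟨C0, hC0, hC0'⟩ := hqc
  obtain ⟨C, hCdef⟩ : ∃ C, C = C0 + 1 := ⟨_, rfl⟩
  have hC : 0 ≤ C := by linarith
  have hA : ∀ g, QCA (wdist S) C (cosetSet H g) := by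
    intro g; rw [hCdef]; exact QCA_coset hd hC0' g
  have hAH : QCA (wdist S) C (H : Set G) := by
    have h1 := hA 1
    have : cosetSet H (1 : G) = (H : Set G) := by ext x; simp [cosetSet]
    rwa [this] at h1
  have hRinf := reps_infinite hR hinf
  have hempty : ¬ (H : Set G).Infinite → ∀ g, cosetLimitSet S H g = ∅ := by
    intro hH g
    apply limit_finite _ _ hd
    refine ((Set.not_infinite.1 hH).image (fun h => g * h)).subset ?_
    intro x hx
    exact ⟨g⁻¹ * x, hx, by simp⟩
  have hone : ∀ g : G, g ∈ cosetSet H g := by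
    intro g
    show g⁻¹ * g ∈ H
    rw [inv_mul_cancel]; exact H.one_mem
  refine ⟨?_, ?_, ?_, hRinf, ?_⟩
  · intro σ hσ hne ⟨ξ, hξ⟩
    have hξ' : ∀ r ∈ σ, ξ ∈ limitSetD (wdist S) 1 (cosetSet H (r : G)) := by
      simp only [Set.mem_iInter] at hξ
      exact hξ
    have hHinf : (H : Set G).Infinite := by
      by_contra hH
      obtain ⟨r, hr⟩ := hne
      have h1 : ξ ∈ cosetLimitSet S H (r : G) := hξ' r hr
      rw [hempty hH] at h1
      exact h1
    refine ⟨hHinf, ?_⟩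
    obtain ⟨N, hN⟩ := inf_many hd hδ hδ0 hR hRinf hA hσ hne hξ'
    obtain ⟨N', hN'⟩ := exists_nat_ge (N + 2 * C)
    refine ⟨N', hN.mono ?_⟩
    intro s hs r hr
    obtain ⟨x, hx, y, hy, hxy⟩ := hs r hr
    obtain ⟨p, hp, hxp⟩ := coset_near_join hd hHinf hC hAH _ x hx
    obtain ⟨q, hq, hyq⟩ := coset_near_join hd hHinf hC hAH _ y hy
    have h1 := setDist_le hd.nonneg hp hq
    have h2 := hd.tri p x q
    have h3 := hd.tri x y q
    rw [hd.symm p x] at h2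
    refine h1.trans ?_
    linarith
  · intro hHinf σ hne N hN
    obtain ⟨ξ, hξ⟩ := inter_of_inf hd hδ hδ0 hR hA hne (N := N + 1 + 2 * (6 * δ + C)) (by
      refine hN.mono ?_
      intro s hs r hr
      have h1 := hs r hr
      obtain ⟨p0, hp0, -⟩ := coset_near_join hd hHinf hC hAH (r : G) r (hone _)
      obtain ⟨q0, hq0, -⟩ := coset_near_join hd hHinf hC hAH (s : G) s (hone _)
      obtain ⟨_, ⟨p, hp, q, hq, rfl⟩, hpq⟩ := exists_lt_of_csInf_lt
        (s := {t | ∃ a ∈ cosetJoin S H (r : G), ∃ b ∈ cosetJoin S H (s : G), t = wdist S a b})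
        ⟨_, p0, hp0, q0, hq0, rfl⟩ (lt_of_le_of_lt h1 (lt_add_one (N : ℝ)))
      obtain ⟨x, hx, hpx⟩ := join_near hd hδ hδ0 (hA _) hp
      obtain ⟨y, hy, hqy⟩ := join_near hd hδ hδ0 (hA _) hq
      refine ⟨x, hx, y, hy, ?_⟩
      have h2 := hd.tri x p y
      have h3 := hd.tri p q y
      rw [hd.symm x p] at h2
      linarith)
    refine ⟨ξ, ?_⟩
    simp only [Set.mem_iInter]
    exact hξ
  · refine ⟨(hd.fin (10 * δ + C)).toFinset.card, ?_⟩
    rintro σ ⟨ξ, hξ⟩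
    rcases σ.eq_empty_or_nonempty with rfl | hne
    · simp
    have hξ' : ∀ r ∈ (σ : Set R), ξ ∈ limitSetD (wdist S) 1 (cosetSet H (r : G)) := by
      simp only [Set.mem_iInter] at hξ
      exact hξ
    obtain ⟨T0, hT0⟩ := deep_points hd hδ hδ0 (A := fun r : R => cosetSet H (r : G))
      (fun r => hA r) σ.finite_toSet hne hξ'
    obtain ⟨p, -, hp⟩ := hT0 T0 le_rfl
    exact card_bound hd hR _ p σ hp
  · intro hH r s
    have : cosetJoin S H (r : G) = ∅ := by
      rw [Set.eq_empty_iff_forall_notMem]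
      rintro p ⟨γ, -, ⟨⟨ξ, hξ, -⟩, -⟩, -⟩
      rw [hempty hH] at hξ
      exact hξ
    rw [this]
    simp [setDistD]

theorem one_direction {G₁ : Type*} [Group G₁] {G₂ : Type*} [Group G₂]
    {S₁ : Set G₁} {S₂ : Set G₂} {H₁ : Subgroup G₁} {H₂ : Subgroup G₂} {R₁ : Set G₁} {R₂ : Set G₂}
    (P₁ : Pkg S₁ H₁ R₁) (P₂ : Pkg S₂ H₂ R₂) (φ : R₁ → R₂) (hφ : Function.Injective φ)
    (hprop : UProperD (wdist S₁) (wdist S₂)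
      (fun r : R₁ => cosetJoin S₁ H₁ (r : G₁))
      (fun r : R₂ => cosetJoin S₂ H₂ (r : G₂)) φ)
    (σ : Set R₁) (hσ : σ.Finite) (hne : σ.Nonempty)
    (h : (⋂ r ∈ σ, cosetLimitSet S₁ H₁ (r : G₁)).Nonempty) :
    (⋂ r ∈ φ '' σ, cosetLimitSet S₂ H₂ (r : G₂)).Nonempty := by
  obtain ⟨f, hf⟩ := hprop
  obtain ⟨hH₁, N, hN⟩ := P₁.fwd σ hσ hne h
  by_cases hH₂ : (H₂ : Set G₂).Infinite
  · refine P₂.bwd hH₂ _ (hne.image φ) (f N) ?_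
    refine (hN.image hφ.injOn).mono ?_
    rintro _ ⟨s, hs, rfl⟩ _ ⟨r, hr, rfl⟩
    exact (hf N r s).1 (hs r hr)
  · exfalso
    obtain ⟨M, hM⟩ := P₁.width
    have := P₁.inf
    obtain ⟨B, hB⟩ := Infinite.exists_subset_card_eq R₁ (M + 1)
    have hBne : B.Nonempty := by
      rw [← Finset.card_pos]; omega
    have h1 := hM B (P₁.bwd hH₁ _ hBne (f 0) (by
      refine (Set.infinite_univ (α := R₁)).mono ?_
      intro s _ r _
      refine (hf 0 r s).2 ?_
      have := P₂.triv hH₂ (φ r) (φ s)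
      simp only [this]
      simp))
    omega

end Main

/-- **Theorem (isomccx).** A uniformly proper bijection `φ : 𝒥₁ → 𝒥₂` between the
collections of joins of translates of the limit sets of quasiconvex subgroups
`Hᵢ ≤ Gᵢ` of infinite index induces a simplicial isomorphism of the `C`-complexes
`C(G₁, H₁)` and `C(G₂, H₂)`: `φ` is a bijection on vertices (translates of the
limit set, indexed by coset representatives), and finitely many distinct vertices
span a simplex (i.e. the corresponding translates of the limit set have nonempty
intersection) if and only if their `φ`-images do. -/
theorem uniformly_proper_induces_C_complex_isomorphism
    {G₁ : Type*} [Group G₁] {G₂ : Type*} [Group G₂]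
    (S₁ : Set G₁) (S₂ : Set G₂) (hS₁fin : S₁.Finite) (hS₂fin : S₂.Finite)
    (hS₁gen : Subgroup.closure S₁ = ⊤) (hS₂gen : Subgroup.closure S₂ = ⊤)
    (hhyp₁ : HypD (wdist S₁)) (hhyp₂ : HypD (wdist S₂))
    (H₁ : Subgroup G₁) (H₂ : Subgroup G₂)
    (hqc₁ : QCSubgroup S₁ H₁) (hqc₂ : QCSubgroup S₂ H₂)
    (hinf₁ : Infinite (G₁ ⧸ H₁)) (hinf₂ : Infinite (G₂ ⧸ H₂))
    (R₁ : Set G₁) (R₂ : Set G₂) (hR₁ : IsCosetReps H₁ R₁) (hR₂ : IsCosetReps H₂ R₂)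
    (φ : R₁ → R₂) (hφ : Function.Bijective φ)
    (hprop : UProperD (wdist S₁) (wdist S₂)
      (fun r : R₁ => cosetJoin S₁ H₁ (r : G₁))
      (fun r : R₂ => cosetJoin S₂ H₂ (r : G₂)) φ) :
    ∀ σ : Set R₁, σ.Finite → σ.Nonempty →
      ((⋂ r ∈ σ, cosetLimitSet S₁ H₁ (r : G₁)).Nonempty ↔
        (⋂ r ∈ φ '' σ, cosetLimitSet S₂ H₂ (r : G₂)).Nonempty) := by
  have P₁ := pkg S₁ hS₁fin hS₁gen hhyp₁ H₁ hqc₁ hinf₁ R₁ hR₁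
  have P₂ := pkg S₂ hS₂fin hS₂gen hhyp₂ H₂ hqc₂ hinf₂ R₂ hR₂
  intro σ hσ hne
  refine ⟨one_direction P₁ P₂ φ hφ.1 hprop σ hσ hne, fun h => ?_⟩
  set e := Equiv.ofBijective φ hφ with he
  have hprop' : UProperD (wdist S₂) (wdist S₁)
      (fun r : R₂ => cosetJoin S₂ H₂ (r : G₂))
      (fun r : R₁ => cosetJoin S₁ H₁ (r : G₁)) e.symm := by
    obtain ⟨f, hf⟩ := hprop
    refine ⟨f, fun n i i' => ?_⟩
    have h1 := hf n (e.symm i) (e.symm i')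
    have e1 : ∀ j, φ (e.symm j) = j := fun j => e.apply_symm_apply j
    rw [e1, e1] at h1
    exact ⟨h1.2, h1.1⟩
  have h2 := one_direction P₂ P₁ e.symm e.symm.injective hprop' (φ '' σ) (hσ.image φ)
    (hne.image φ) h
  have e2 : e.symm '' (φ '' σ) = σ := e.symm_image_image σ
  rwa [e2] at h2

end RelRig
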